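/- arXiv:1907.07172 — 2 statements merged into one kernel-verified Lean document; each statement's English description precedes it below -/
import Mathlib

section
/- Let σ > 0 and let f : ℝ → ℝ be the normal density with mean zero and variance σ², f(x) = exp(−x²/(2σ²))/(σ·√(2π)). Let π, τ be permutations of {1,…,n+1}. If lev(π)_{i,j} ≤ lev(τ)_{i,j} for all 1 ≤ i ≤ j ≤ n, then P(f,π) ≥ P(f,τ). -/
open MeasureTheory

noncomputable section

/-- Walk positions: `walk n x i = x 0 + ⋯ + x (i-1)` (so `walk n x 0 = 0`). -/
def walk (n : ℕ) (x : Fin n → ℝ) (i : Fin (n + 1)) : ℝ :=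
  ∑ j : Fin n, if (j : ℕ) < (i : ℕ) then x j else 0

/-- The region of step tuples generating the ordinal pattern `π`. -/
def D (n : ℕ) (π : Equiv.Perm (Fin (n + 1))) : Set (Fin n → ℝ) :=
  {x | (∀ i j : Fin (n + 1), i ≠ j → walk n x i ≠ walk n x j) ∧
       (∀ i j : Fin (n + 1), walk n x i < walk n x j ↔ π i < π j)}

/-- The matrix `L_π`. -/
def L (n : ℕ) (π : Equiv.Perm (Fin (n + 1))) : Matrix (Fin n) (Fin n) ℝ :=
  fun i j =>
    if (π i.castSucc : ℕ) ≤ (j : ℕ) ∧ (j : ℕ) < (π i.succ : ℕ) then 1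
    else if (π i.succ : ℕ) ≤ (j : ℕ) ∧ (j : ℕ) < (π i.castSucc : ℕ) then -1
    else 0

/-- Partial sum `x i + x (i+1) + ⋯ + x (j-1)`. -/
def psum (n : ℕ) (x : Fin n → ℝ) (i j : Fin (n + 1)) : ℝ :=
  ∑ k : Fin n, if (i : ℕ) ≤ (k : ℕ) ∧ (k : ℕ) < (j : ℕ) then x k else 0

/-- The level count `lev(π)_j`. -/
def lev (n : ℕ) (π : Equiv.Perm (Fin (n + 1))) (j : Fin n) : ℕ :=
  (Finset.univ.filter fun i : Fin n =>
    ((π i.castSucc : ℕ) ≤ (j : ℕ) ∧ (j : ℕ) < (π i.succ : ℕ)) ∨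
    ((π i.succ : ℕ) ≤ (j : ℕ) ∧ (j : ℕ) < (π i.castSucc : ℕ))).card

/-- The polytope of steps `P_π`. -/
def Ppoly (n : ℕ) (π : Equiv.Perm (Fin (n + 1))) : Set (Fin n → ℝ) :=
  {x | (∀ i, 0 ≤ x i) ∧ ∀ i : Fin n,
    psum n x (min (π i.castSucc) (π i.succ)) (max (π i.castSucc) (π i.succ)) ≤ 1}

/-- The set of positive roots, identified with pairs `i < j`. -/
def PosRoot (n : ℕ) := {p : Fin (n + 1) × Fin (n + 1) // p.1 < p.2}

/-- The Shi condition for an alcove address. -/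
def Shi (n : ℕ) (k : PosRoot n → ℤ) : Prop :=
  ∀ (i t j : Fin (n + 1)) (hit : i < t) (htj : t < j),
    k ⟨(i, t), hit⟩ + k ⟨(t, j), htj⟩ ≤ k ⟨(i, j), hit.trans htj⟩ ∧
    k ⟨(i, j), hit.trans htj⟩ ≤ k ⟨(i, t), hit⟩ + k ⟨(t, j), htj⟩ + 1

/-- The alcove with address `k`, in step coordinates. -/
def alcove (n : ℕ) (k : PosRoot n → ℤ) : Set (Fin n → ℝ) :=
  {x | ∀ p : PosRoot n,
    (k p : ℝ) < psum n x p.1.1 p.1.2 ∧ psum n x p.1.1 p.1.2 < (k p : ℝ) + 1}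

/-- The root ideal `I_π`. -/
def rootIdeal (n : ℕ) (π : Equiv.Perm (Fin (n + 1))) : Set (PosRoot n) :=
  {p | ∃ c : Fin n,
    min (π c.castSucc : ℕ) (π c.succ : ℕ) ≤ (p.1.1 : ℕ) ∧
    (p.1.2 : ℕ) ≤ max (π c.castSucc : ℕ) (π c.succ : ℕ)}

/-- The level count matrix `lev(π)_{i,j}`. -/
def lev2 (n : ℕ) (π : Equiv.Perm (Fin (n + 1))) (i j : Fin n) : ℕ :=
  (Finset.univ.filter fun k : Fin n =>
    ((π k.castSucc : ℕ) ≤ (i : ℕ) ∧ (π k.castSucc : ℕ) ≤ (j : ℕ) ∧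
     (i : ℕ) < (π k.succ : ℕ) ∧ (j : ℕ) < (π k.succ : ℕ)) ∨
    ((π k.succ : ℕ) ≤ (i : ℕ) ∧ (π k.succ : ℕ) ≤ (j : ℕ) ∧
     (i : ℕ) < (π k.castSucc : ℕ) ∧ (j : ℕ) < (π k.castSucc : ℕ))).card

lemma walk_zero (n : ℕ) (x : Fin n → ℝ) : walk n x 0 = 0 := by
  simp [walk]

lemma walk_succ (n : ℕ) (x : Fin n → ℝ) (k : Fin n) :
    walk n x k.succ = walk n x k.castSucc + x k := by
  have hx : x k = ∑ j : Fin n, if j = k then x j else 0 := by simp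
  rw [hx, walk, walk, ← Finset.sum_add_distrib]
  refine Finset.sum_congr rfl fun j _ => ?_
  simp only [Fin.val_succ, Fin.val_castSucc, Fin.ext_iff]
  split_ifs <;> first | omega | simp

/-- The linear map sending the gaps `y` between consecutive levels to the steps of the walk
with ordinal pattern `π` whose sorted positions have these gaps. -/
def stepMap (n : ℕ) (π : Equiv.Perm (Fin (n + 1))) : (Fin n → ℝ) →ₗ[ℝ] (Fin n → ℝ) where
  toFun y k := walk n y (π k.succ) - walk n y (π k.castSucc)
  map_add' y z := by
    have h (i) : walk n (y + z) i = walk n y i + walk n z i := by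
      simp only [walk, ← Finset.sum_add_distrib]
      exact Finset.sum_congr rfl fun j _ => by split_ifs <;> simp
    ext k
    simp only [h, Pi.add_apply]
    ring
  map_smul' c y := by
    have h (i) : walk n (c • y) i = c * walk n y i := by
      simp only [walk, Finset.mul_sum]
      exact Finset.sum_congr rfl fun j _ => by split_ifs <;> simp
    ext k
    simp only [h, Pi.smul_apply, smul_eq_mul, RingHom.id_apply]
    ring

lemma stepMap_apply (n : ℕ) (π : Equiv.Perm (Fin (n + 1))) (y : Fin n → ℝ) (k : Fin n) :
    stepMap n π y k = walk n y (π k.succ) - walk n y (π k.castSucc) := rfl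

lemma walk_stepMap (n : ℕ) (π : Equiv.Perm (Fin (n + 1))) (y : Fin n → ℝ) (i : Fin (n + 1)) :
    walk n (stepMap n π y) i = walk n y (π i) - walk n y (π 0) := by
  induction i using Fin.induction with
  | zero => simp [walk_zero]
  | succ k ih => rw [walk_succ, ih, stepMap_apply]; ring

lemma stepMap_one (n : ℕ) : stepMap n 1 = 1 := by
  refine LinearMap.ext fun y => funext fun k => ?_
  simp [stepMap_apply, walk_succ]

lemma stepMap_mul (n : ℕ) (π τ : Equiv.Perm (Fin (n + 1))) :
    stepMap n (π * τ) = stepMap n τ * stepMap n π := by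
  refine LinearMap.ext fun y => funext fun k => ?_
  simp [stepMap_apply, walk_stepMap, Module.End.mul_apply]

lemma stepMap_pow (n : ℕ) (π : Equiv.Perm (Fin (n + 1))) (m : ℕ) :
    stepMap n (π ^ m) = stepMap n π ^ m := by
  induction m with
  | zero => simp [stepMap_one]
  | succ m ih => rw [pow_succ, stepMap_mul, ih, pow_succ']

lemma abs_det_stepMap (n : ℕ) (π : Equiv.Perm (Fin (n + 1))) :
    |LinearMap.det (stepMap n π)| = 1 := by
  have h : LinearMap.det (stepMap n π) ^ orderOf π = 1 := by
    rw [← map_pow, ← stepMap_pow, pow_orderOf_eq_one, stepMap_one, map_one]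
  have h' : |LinearMap.det (stepMap n π)| ^ orderOf π = 1 := by
    rw [← abs_pow, h, abs_one]
  exact (pow_eq_one_iff_of_nonneg (abs_nonneg _) (orderOf_pos π).ne').1 h'

lemma measurePreserving_stepMap (n : ℕ) (π : Equiv.Perm (Fin (n + 1))) :
    MeasurePreserving (stepMap n π) := by
  refine ⟨(LinearMap.continuous_of_finiteDimensional _).measurable, ?_⟩
  have h := abs_det_stepMap n π
  rw [Real.map_linearMap_volume_pi_eq_smul_volume_pi, abs_inv, h]
  · simp
  · intro h0
    simp [h0] at h

lemma measurableEmbedding_stepMap (n : ℕ) (π : Equiv.Perm (Fin (n + 1))) :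
    MeasurableEmbedding (stepMap n π) := by
  refine (LinearMap.continuous_of_finiteDimensional (stepMap n π)).measurableEmbedding ?_
  refine Function.LeftInverse.injective (g := stepMap n π⁻¹) fun y => ?_
  rw [← Module.End.mul_apply, ← stepMap_mul, mul_inv_cancel, stepMap_one, Module.End.one_apply]

lemma strictMono_walk_iff (n : ℕ) (y : Fin n → ℝ) :
    StrictMono (walk n y) ↔ ∀ j, 0 < y j := by
  simp [Fin.strictMono_iff_lt_succ, walk_succ]

lemma stepMap_preimage_D (n : ℕ) (π : Equiv.Perm (Fin (n + 1))) :
    stepMap n π ⁻¹' D n π = {y | ∀ j, 0 < y j} := by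
  ext y
  simp only [D, Set.mem_preimage, Set.mem_ofPred_eq, walk_stepMap, ← strictMono_walk_iff,
    sub_lt_sub_iff_right, ne_eq, sub_left_inj]
  constructor
  · rintro ⟨-, h⟩ a b hab
    simpa using (h (π.symm a) (π.symm b)).2 (by simpa using hab)
  · intro h
    exact ⟨fun i j hij e => hij (π.injective (h.injective e)), fun i j => h.lt_iff_lt⟩

lemma sum_sq_stepMap (n : ℕ) (π : Equiv.Perm (Fin (n + 1))) (y : Fin n → ℝ) :
    ∑ k, stepMap n π y k ^ 2 = ∑ i, ∑ j, (lev2 n π i j : ℝ) * (y i * y j) := by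
  have h (k : Fin n) : stepMap n π y k ^ 2 = ∑ i : Fin n, ∑ j : Fin n,
      (if ((π k.castSucc : ℕ) ≤ (i : ℕ) ∧ (π k.castSucc : ℕ) ≤ (j : ℕ) ∧
          (i : ℕ) < (π k.succ : ℕ) ∧ (j : ℕ) < (π k.succ : ℕ)) ∨
        ((π k.succ : ℕ) ≤ (i : ℕ) ∧ (π k.succ : ℕ) ≤ (j : ℕ) ∧
          (i : ℕ) < (π k.castSucc : ℕ) ∧ (j : ℕ) < (π k.castSucc : ℕ)) then (1 : ℝ) else 0) *
        (y i * y j) := by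
    rw [stepMap_apply, walk, walk, ← Finset.sum_sub_distrib, sq, Finset.sum_mul_sum]
    refine Finset.sum_congr rfl fun i _ => Finset.sum_congr rfl fun j _ => ?_
    split_ifs <;> first | omega | ring
  simp only [h]
  rw [Finset.sum_comm]
  refine Finset.sum_congr rfl fun i _ => ?_
  rw [Finset.sum_comm]
  refine Finset.sum_congr rfl fun j _ => ?_
  rw [← Finset.sum_mul, Finset.sum_boole, lev2]

lemma lev2_comm (n : ℕ) (π : Equiv.Perm (Fin (n + 1))) (i j : Fin n) :
    lev2 n π i j = lev2 n π j i := by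
  simp only [lev2]
  congr 1
  ext k
  simp only [Finset.mem_filter, Finset.mem_univ, true_and]
  omega

lemma integrable_prod_gaussian (n : ℕ) {σ : ℝ} (hσ : 0 < σ) :
    Integrable fun x : Fin n → ℝ => ∏ i : Fin n,
      Real.exp (-(x i) ^ 2 / (2 * σ ^ 2)) / (σ * Real.sqrt (2 * Real.pi)) := by
  refine Integrable.fintype_prod (f := fun (_ : Fin n) (t : ℝ) =>
    Real.exp (-t ^ 2 / (2 * σ ^ 2)) / (σ * Real.sqrt (2 * Real.pi))) fun _ => ?_
  have h := integrable_exp_neg_mul_sq (b := 1 / (2 * σ ^ 2)) (by positivity)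
  refine (h.congr (ae_of_all _ fun t => ?_)).div_const _
  dsimp only
  congr 1
  ring

lemma prod_gaussian_eq (n : ℕ) (σ : ℝ) (x : Fin n → ℝ) :
    ∏ i : Fin n, Real.exp (-(x i) ^ 2 / (2 * σ ^ 2)) / (σ * Real.sqrt (2 * Real.pi)) =
      Real.exp (-(∑ i, x i ^ 2) / (2 * σ ^ 2)) / (σ * Real.sqrt (2 * Real.pi)) ^ n := by
  rw [Finset.prod_div_distrib, ← Real.exp_sum, ← Finset.sum_div, Finset.sum_neg_distrib]
  simp

/-- for a mean-zero normal density, `lev(π)_{i,j} ≤ lev(τ)_{i,j}` for all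
`i ≤ j` implies `P(f,π) ≥ P(f,τ)`. -/
theorem stmt_18 (n : ℕ) (hn : 1 ≤ n) (σ : ℝ) (hσ : 0 < σ)
    (π τ : Equiv.Perm (Fin (n + 1)))
    (hlev : ∀ i j : Fin n, i ≤ j → lev2 n π i j ≤ lev2 n τ i j) :
    ∫ x in D n τ, ∏ i : Fin n,
        Real.exp (-(x i) ^ 2 / (2 * σ ^ 2)) / (σ * Real.sqrt (2 * Real.pi)) ≤
    ∫ x in D n π, ∏ i : Fin n,
        Real.exp (-(x i) ^ 2 / (2 * σ ^ 2)) / (σ * Real.sqrt (2 * Real.pi)) := by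
  rw [← (measurePreserving_stepMap n τ).setIntegral_preimage_emb
      (measurableEmbedding_stepMap n τ) _ (D n τ), stepMap_preimage_D,
    ← (measurePreserving_stepMap n π).setIntegral_preimage_emb
      (measurableEmbedding_stepMap n π) _ (D n π), stepMap_preimage_D]
  have integrable_step (ρ : Equiv.Perm (Fin (n + 1))) :=
    ((measurePreserving_stepMap n ρ).integrable_comp_emb
      (measurableEmbedding_stepMap n ρ)).2 (integrable_prod_gaussian n hσ)
  refine setIntegral_mono_on (integrable_step τ).integrableOn (integrable_step π).integrableOn ?_ fun y hy => ?_
  · simp only [Set.ofPred_forall]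
    exact MeasurableSet.iInter fun j => measurableSet_lt measurable_const (measurable_pi_apply j)
  · rw [prod_gaussian_eq, prod_gaussian_eq, sum_sq_stepMap, sum_sq_stepMap]
    have hle (i j : Fin n) : lev2 n π i j ≤ lev2 n τ i j := by
      rcases le_total i j with h | h
      · exact hlev i j h
      · rw [lev2_comm n π, lev2_comm n τ]
        exact hlev j i h
    gcongr with i _ j _
    · exact mul_nonneg (hy i).le (hy j).le
    · exact hle i j
end
end

section
/- Let f(x) = exp(−x²/2)/√(2π) be the standard normal density, let π be a permutation of {1,…,n+1}, let r > 0, and let B = {x ∈ ℝ^n : ‖x‖ < r} be the open Euclidean ball of radius r centered at the origin. Let m_π be the number of functions k : Φ⁺ → ℤ satisfying the Shi condition with A_k ⊆ D_π and A_k ⊆ B, and let M_π be the number of functions k : Φ⁺ → ℤ satisfying the Shi condition with A_k ⊆ D_π and A_k ∩ B ≠ ∅. Then both counting sets are finite and m_π/(n! · λ(B)) ≤ P(f,π) ≤ M_π/(n! · λ(B)), where λ is Lebesgue measure on ℝ^n. -/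
open MeasureTheory

noncomputable section

/-- The open Euclidean ball of radius `r` centered at the origin of `ℝ^n`. -/
def eball (n : ℕ) (r : ℝ) : Set (Fin n → ℝ) := {x | ∑ i, x i ^ 2 < r ^ 2}

/-- Shi addresses whose alcove lies in `D_π` and is fully contained in the ball. -/
def innerAlcoves (n : ℕ) (π : Equiv.Perm (Fin (n + 1))) (r : ℝ) :
    Set (PosRoot n → ℤ) :=
  {k | Shi n k ∧ alcove n k ⊆ D n π ∧ alcove n k ⊆ eball n r}

/-- Shi addresses whose alcove lies in `D_π` and meets the ball. -/
def touchingAlcoves (n : ℕ) (π : Equiv.Perm (Fin (n + 1))) (r : ℝ) :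
    Set (PosRoot n → ℤ) :=
  {k | Shi n k ∧ alcove n k ⊆ D n π ∧ (alcove n k ∩ eball n r).Nonempty}

lemma measurable_walk (n : ℕ) (i : Fin (n + 1)) : Measurable fun x => walk n x i := by
  unfold walk
  refine Finset.measurable_sum _ fun j _ => ?_
  split_ifs
  · exact measurable_pi_apply j
  · exact measurable_const

lemma psum_eq_walk_sub (n : ℕ) (x : Fin n → ℝ) {i j : Fin (n + 1)} (h : i ≤ j) :
    psum n x i j = walk n x j - walk n x i := by
  unfold psum walk
  rw [← Finset.sum_sub_distrib]
  refine Finset.sum_congr rfl fun k _ => ?_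
  have : (i : ℕ) ≤ j := h
  split_ifs <;> first | omega | simp

lemma mem_alcove_iff (n : ℕ) (k : PosRoot n → ℤ) (x : Fin n → ℝ) :
    x ∈ alcove n k ↔ ∀ (i j : Fin (n + 1)) (h : i < j),
      (k ⟨(i, j), h⟩ : ℝ) < walk n x j - walk n x i ∧
        walk n x j - walk n x i < (k ⟨(i, j), h⟩ : ℝ) + 1 := by
  constructor
  · intro hx i j h
    have := hx ⟨(i, j), h⟩
    rwa [psum_eq_walk_sub n x h.le] at this
  · rintro hx ⟨⟨i, j⟩, h⟩
    rw [psum_eq_walk_sub n x (le_of_lt h)]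
    exact hx i j h

lemma walk_smul (n : ℕ) (c : ℝ) (x : Fin n → ℝ) (i : Fin (n + 1)) :
    walk n (c • x) i = c * walk n x i := by
  simp [walk, Finset.mul_sum, mul_ite]

lemma measurableSet_alcove (n : ℕ) (k : PosRoot n → ℤ) : MeasurableSet (alcove n k) := by
  have : alcove n k = ⋂ (i : Fin (n + 1)) (j : Fin (n + 1)) (h : i < j),
      (fun x => walk n x j - walk n x i) ⁻¹'
        Set.Ioo (k ⟨(i, j), h⟩ : ℝ) ((k ⟨(i, j), h⟩ : ℝ) + 1) := by
    ext x
    simp only [mem_alcove_iff, Set.mem_iInter, Set.mem_preimage, Set.mem_Ioo]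
  rw [this]
  exact MeasurableSet.iInter fun i => MeasurableSet.iInter fun j => MeasurableSet.iInter fun h =>
    ((measurable_walk n j).sub (measurable_walk n i)) measurableSet_Ioo

lemma smul_mem_D {n : ℕ} {π : Equiv.Perm (Fin (n + 1))} {c : ℝ} (hc : 0 < c) {x : Fin n → ℝ}
    (hx : x ∈ D n π) : c • x ∈ D n π := by
  refine ⟨fun i j h => ?_, fun i j => ?_⟩
  · rw [walk_smul, walk_smul]
    exact fun h' => hx.1 i j h (mul_left_cancel₀ hc.ne' h')
  · rw [walk_smul, walk_smul, mul_lt_mul_iff_right₀ hc]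
    exact hx.2 i j

lemma measurePreserving_walk_succ (n : ℕ) :
    MeasurePreserving (fun (x : Fin n → ℝ) (i : Fin n) => walk n x i.succ) := by
  let M : Matrix (Fin n) (Fin n) ℝ := fun i j => if j ≤ i then 1 else 0
  have hM : M.det = 1 := by
    rw [Matrix.det_of_isLowerTriangular]
    · simp [M]
    · intro i j hij
      have : i < j := hij
      simp [M, this]
  have hf : (fun (x : Fin n → ℝ) (i : Fin n) => walk n x i.succ) = Matrix.toLin' M := by
    funext x i
    rw [Matrix.toLin'_apply]
    refine Finset.sum_congr rfl fun j _ => ?_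
    have h : (j : ℕ) < (i.succ : ℕ) ↔ j ≤ i := by
      rw [Fin.le_def, Fin.val_succ, Nat.lt_succ_iff]
    by_cases hji : j ≤ i
    · rw [if_pos (h.2 hji)]; simp [M, hji]
    · rw [if_neg (mt h.1 hji)]; simp [M, hji]
  refine ⟨measurable_pi_lambda _ fun i => measurable_walk n _, ?_⟩
  rw [hf, Real.map_matrix_volume_pi_eq_smul_volume_pi (by simp [hM])]
  simp [hM]

/-- Strictly increasing tuples in the open unit cube. -/
def orderedCube (n : ℕ) : Set (Fin n → ℝ) := {c | (∀ i, c i ∈ Set.Ioo (0 : ℝ) 1) ∧ StrictMono c}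

lemma measurableSet_orderedCube (n : ℕ) : MeasurableSet (orderedCube n) := by
  refine MeasurableSet.inter (s₁ := {c : Fin n → ℝ | ∀ i, c i ∈ Set.Ioo (0 : ℝ) 1})
    (s₂ := {c : Fin n → ℝ | StrictMono c}) ?_ ?_
  · simp only [Set.ofPred_forall]
    exact MeasurableSet.iInter fun i => measurable_pi_apply i measurableSet_Ioo
  · simp only [StrictMono, Set.ofPred_forall]
    exact MeasurableSet.iInter fun i => MeasurableSet.iInter fun j => MeasurableSet.iInter fun _ =>
      measurableSet_lt (measurable_pi_apply i) (measurable_pi_apply j)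

lemma measurePreserving_comp_perm {n : ℕ} (σ : Equiv.Perm (Fin n)) :
    MeasurePreserving (fun c : Fin n → ℝ => c ∘ σ) := by
  have h := volume_measurePreserving_piCongrLeft (fun _ : Fin n => ℝ) σ.symm
  have he : (fun c : Fin n → ℝ => c ∘ σ) =
      MeasurableEquiv.piCongrLeft (fun _ : Fin n => ℝ) σ.symm := by
    funext c i
    obtain ⟨j, rfl⟩ := σ.symm.surjective i
    simp [MeasurableEquiv.piCongrLeft, Equiv.piCongrLeft_apply_apply]
  rwa [he]

/-- Level sets of nonzero linear functionals are null. -/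
lemma volume_linear_eq_const {n : ℕ} {ℓ : (Fin n → ℝ) →ₗ[ℝ] ℝ} (hl : ℓ ≠ 0) (a : ℝ) :
    volume {x | ℓ x = a} = 0 := by
  let S : AffineSubspace ℝ (Fin n → ℝ) := (AffineSubspace.mk' a ⊥).comap ℓ.toAffineMap
  have hS : (S : Set (Fin n → ℝ)) = {x | ℓ x = a} := by
    ext x
    simp [S, AffineSubspace.mem_mk', sub_eq_zero]
  rw [← hS]
  refine Measure.addHaar_affineSubspace _ S fun h => hl ?_
  have hx : ∀ x, ℓ x = a := fun x => by
    have : x ∈ (S : Set (Fin n → ℝ)) := by rw [h]; trivial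
    rwa [hS] at this
  exact LinearMap.ext fun x => by rw [hx x, ← hx 0, map_zero, LinearMap.zero_apply]

lemma volume_orderedCube (n : ℕ) : volume (orderedCube n) = (n.factorial : ENNReal)⁻¹ := by
  let T : Equiv.Perm (Fin n) → Set (Fin n → ℝ) := fun σ => (fun c => c ∘ σ) ⁻¹' orderedCube n
  have hT : ∀ σ, volume (T σ) = volume (orderedCube n) := fun σ =>
    (measurePreserving_comp_perm σ).measure_preimage (measurableSet_orderedCube n).nullMeasurableSet
  have hcube : volume (Set.pi Set.univ fun _ : Fin n => Set.Ioo (0 : ℝ) 1) = 1 := by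
    simp [Real.volume_pi_Ioo]
  have hae : (Set.pi Set.univ fun _ : Fin n => Set.Ioo (0 : ℝ) 1) =ᵐ[volume] ⋃ σ, T σ := by
    have hinj : ∀ᵐ c : Fin n → ℝ, ∀ i j, i ≠ j → c i ≠ c j := by
      simp only [ae_all_iff]
      intro i j hij
      let ℓ : (Fin n → ℝ) →ₗ[ℝ] ℝ :=
        LinearMap.proj (R := ℝ) (φ := fun _ : Fin n => ℝ) i - LinearMap.proj j
      have hl : ∀ x, ℓ x = x i - x j := fun x => LinearMap.sub_apply _ _ _
      have hne : ℓ ≠ 0 := fun h => by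
        have h1 := hl (Pi.single i 1)
        simp [h, hij.symm] at h1
      have := volume_linear_eq_const hne 0
      rw [ae_iff]
      simpa [hl, sub_eq_zero] using this
    filter_upwards [hinj] with c hc
    refine propext ⟨fun h => ?_, fun h => ?_⟩
    · refine Set.mem_iUnion.2 ⟨Tuple.sort c, fun i => h _ trivial, ?_⟩
      refine (Tuple.monotone_sort c).strictMono_of_injective fun a b hab => ?_
      by_contra hne
      exact hc _ _ ((Tuple.sort c).injective.ne hne) hab
    · obtain ⟨σ, hσ, -⟩ := Set.mem_iUnion.1 h
      intro i _
      simpa using hσ (σ.symm i)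
  have hdisj : Pairwise (Function.onFun Disjoint T) := by
    intro σ τ hne
    refine Set.disjoint_left.2 fun c hσ hτ => hne ?_
    have h1 := hσ.2
    have h2 := hτ.2
    have hinj : Function.Injective c := by
      have := h1.injective.comp σ.symm.injective
      simpa [Function.comp_assoc] using this
    have := Tuple.unique_monotone h1.monotone h2.monotone
    exact Equiv.ext fun i => hinj (congrFun this i)
  have hsum : volume (⋃ σ, T σ) = (n.factorial : ENNReal) * volume (orderedCube n) := by
    rw [measure_iUnion hdisj fun σ =>
      (measurePreserving_comp_perm σ).measurable (measurableSet_orderedCube n)]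
    simp [hT, tsum_fintype, Fintype.card_perm]
  rw [← measure_congr hae, hcube] at hsum
  exact ENNReal.eq_inv_of_mul_eq_one_left (by rw [mul_comm]; exact hsum.symm)

/-- A transitive trichotomous asymmetric relation on `Fin n` is listed increasingly by some
permutation. -/
lemma exists_perm_of_trans_trichotomous {n : ℕ} (R : Fin n → Fin n → Prop)
    (hirr : ∀ i, ¬ R i i) (htrans : ∀ i j l, R i j → R j l → R i l)
    (htri : ∀ i j, i ≠ j → R i j ∨ R j i) :
    ∃ σ : Equiv.Perm (Fin n), ∀ a b, a < b ↔ R (σ a) (σ b) := by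
  classical
  let h : Fin n → ℕ := fun i => (Finset.univ.filter fun j => R j i).card
  have hlt : ∀ i j, R i j → h i < h j := by
    intro i j hij
    refine Finset.card_lt_card (Finset.ssubset_iff_of_subset ?_ |>.2 ⟨i, ?_, ?_⟩)
    · intro l hl
      simp only [Finset.mem_filter, Finset.mem_univ, true_and] at hl ⊢
      exact htrans _ _ _ hl hij
    · simpa using hij
    · simpa using hirr i
  have hmono := Tuple.monotone_sort h
  have key : ∀ a b, a < b → R (Tuple.sort h a) (Tuple.sort h b) := by
    intro a b hab
    rcases htri _ _ ((Tuple.sort h).injective.ne hab.ne) with h1 | h1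
    · exact h1
    · exact absurd (hmono hab.le) (not_le.2 (hlt _ _ h1))
  refine ⟨Tuple.sort h, fun a b => ⟨key a b, fun hR => ?_⟩⟩
  rcases lt_trichotomy a b with hab | rfl | hab
  · exact hab
  · exact absurd hR (hirr _)
  · exact absurd (htrans _ _ _ hR (key _ _ hab)) (hirr _)

/-- In walk coordinates a Shi alcove is a translated and permuted copy of the ordered cube. -/
lemma Shi.exists_alcove_eq {n : ℕ} {k : PosRoot n → ℤ} (hk : Shi n k) :
    ∃ (m : Fin n → ℝ) (σ : Equiv.Perm (Fin n)), alcove n k =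
      {x | ((fun i => walk n x i.succ) - m) ∘ σ ∈ orderedCube n} := by
  let m : Fin n → ℤ := fun i => k ⟨(0, i.succ), Fin.succ_pos i⟩
  let κ : ∀ i j : Fin n, i < j → ℤ := fun i j h => k ⟨(i.succ, j.succ), Fin.succ_lt_succ_iff.2 h⟩
  have hκ : ∀ i j (h : i < j), κ i j h ≤ m j - m i ∧ m j - m i - 1 ≤ κ i j h := by
    intro i j h
    have := hk 0 i.succ j.succ (Fin.succ_pos i) (Fin.succ_lt_succ_iff.2 h)
    simp only [m, κ]
    omega
  have hshi : ∀ i t j (h : i < t) (h' : t < j), κ i t h + κ t j h' ≤ κ i j (h.trans h') ∧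
      κ i j (h.trans h') ≤ κ i t h + κ t j h' + 1 := fun i t j h h' =>
    hk i.succ t.succ j.succ (Fin.succ_lt_succ_iff.2 h) (Fin.succ_lt_succ_iff.2 h')
  let R : Fin n → Fin n → Prop := fun i j =>
    (∃ h : i < j, κ i j h = m j - m i) ∨ (∃ h : j < i, κ j i h = m i - m j - 1)
  have hirr : ∀ i, ¬ R i i := by
    rintro i (⟨h, -⟩ | ⟨h, -⟩) <;> exact lt_irrefl _ h
  have htri : ∀ i j, i ≠ j → R i j ∨ R j i := by
    intro i j hij
    rcases lt_or_gt_of_ne hij with h | h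
    · have := hκ i j h
      by_cases h1 : κ i j h = m j - m i
      · exact Or.inl (Or.inl ⟨h, h1⟩)
      · exact Or.inr (Or.inr ⟨h, by omega⟩)
    · have := hκ j i h
      by_cases h1 : κ j i h = m i - m j
      · exact Or.inr (Or.inl ⟨h, h1⟩)
      · exact Or.inl (Or.inr ⟨h, by omega⟩)
  have htrans : ∀ i j l, R i j → R j l → R i l := by
    rintro i j l (⟨h, e⟩ | ⟨h, e⟩) (⟨h', e'⟩ | ⟨h', e'⟩)
    · refine Or.inl ⟨h.trans h', ?_⟩
      have := hshi i j l h h'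
      have := hκ i l (h.trans h')
      omega
    · rcases lt_trichotomy i l with hil | rfl | hil
      · refine Or.inl ⟨hil, ?_⟩
        have := hshi i l j hil h'
        have := hκ i l hil
        omega
      · omega
      · refine Or.inr ⟨hil, ?_⟩
        have := hshi l i j hil h
        have := hκ l i hil
        omega
    · rcases lt_trichotomy i l with hil | rfl | hil
      · refine Or.inl ⟨hil, ?_⟩
        have := hshi j i l h hil
        have := hκ i l hil
        omega
      · omega
      · refine Or.inr ⟨hil, ?_⟩
        have := hshi j l i h' hil
        have := hκ l i hil
        omega
    · refine Or.inr ⟨h'.trans h, ?_⟩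
      have := hshi l j i h' h
      have := hκ l i (h'.trans h)
      omega
  obtain ⟨σ, hσ⟩ := exists_perm_of_trans_trichotomous R hirr htrans htri
  refine ⟨fun i => m i, σ, ?_⟩
  ext x
  let c : Fin n → ℝ := (fun i => walk n x i.succ) - fun i => (m i : ℝ)
  have hc : ∀ i, walk n x i.succ = c i + m i := fun i => by simp [c]
  have hord : StrictMono (c ∘ σ) ↔ ∀ i j, R i j → c i < c j := by
    constructor
    · intro h i j hij
      have := h ((hσ (σ.symm i) (σ.symm j)).2 (by simpa using hij))
      simpa using this
    · exact fun h a b hab => h _ _ ((hσ a b).1 hab)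
  have hbox : (∀ a, (c ∘ σ) a ∈ Set.Ioo (0 : ℝ) 1) ↔ ∀ i, c i ∈ Set.Ioo (0 : ℝ) 1 :=
    σ.forall_congr_right (q := fun i => c i ∈ Set.Ioo (0 : ℝ) 1)
  change _ ↔ (∀ a, (c ∘ σ) a ∈ Set.Ioo (0 : ℝ) 1) ∧ StrictMono (c ∘ σ)
  rw [hbox, hord, mem_alcove_iff]
  constructor
  · intro hx
    refine ⟨fun i => ?_, ?_⟩
    · have h := hx 0 i.succ (Fin.succ_pos i)
      rw [walk_zero, hc] at h
      change (m i : ℝ) < _ ∧ _ < (m i : ℝ) + 1 at h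
      exact ⟨by linarith, by linarith⟩
    · rintro i j (⟨h, e⟩ | ⟨h, e⟩)
      · have h1 : (κ i j h : ℝ) < _ := (hx i.succ j.succ (Fin.succ_lt_succ_iff.2 h)).1
        rw [hc, hc, e] at h1
        push_cast at h1
        linarith
      · have h1 : _ < (κ j i h : ℝ) + 1 := (hx j.succ i.succ (Fin.succ_lt_succ_iff.2 h)).2
        rw [hc, hc, e] at h1
        push_cast at h1
        linarith
  · rintro ⟨h01, hR⟩ i j hij
    obtain ⟨j, rfl⟩ := Fin.eq_succ_of_ne_zero (Fin.ne_zero_of_lt hij)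
    have hj := h01 j
    rcases Fin.eq_zero_or_eq_succ i with rfl | ⟨i, rfl⟩
    · rw [walk_zero, hc]
      change (m j : ℝ) < _ ∧ _ < (m j : ℝ) + 1
      exact ⟨by linarith [hj.1], by linarith [hj.2]⟩
    · have hi := h01 i
      have h : i < j := Fin.succ_lt_succ_iff.1 hij
      rw [hc, hc]
      change (κ i j h : ℝ) < _ ∧ _ < (κ i j h : ℝ) + 1
      have hb := hκ i j h
      by_cases e : κ i j h = m j - m i
      · have := hR i j (Or.inl ⟨h, e⟩)
        rw [e]
        push_cast
        exact ⟨by linarith, by linarith [hj.2, hi.1]⟩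
      · have e' : κ i j h = m j - m i - 1 := by omega
        have := hR j i (Or.inr ⟨h, e'⟩)
        rw [e']
        push_cast
        exact ⟨by linarith [hi.2, hj.1], by linarith⟩

lemma Shi.volume_alcove {n : ℕ} {k : PosRoot n → ℤ} (hk : Shi n k) :
    volume (alcove n k) = (n.factorial : ENNReal)⁻¹ := by
  obtain ⟨m, σ, h⟩ := hk.exists_alcove_eq
  rw [h, ← volume_orderedCube n]
  exact (((measurePreserving_comp_perm σ).comp (measurePreserving_sub_right volume m)).comp
    (measurePreserving_walk_succ n)).measure_preimage
    (measurableSet_orderedCube n).nullMeasurableSet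

lemma Shi.alcove_nonempty {n : ℕ} {k : PosRoot n → ℤ} (hk : Shi n k) : (alcove n k).Nonempty := by
  refine nonempty_of_measure_ne_zero (μ := volume) ?_
  rw [hk.volume_alcove]
  exact ENNReal.inv_ne_zero.2 (ENNReal.natCast_ne_top _)

lemma alcove_eq_of_mem {n : ℕ} {k k' : PosRoot n → ℤ} {x : Fin n → ℝ} (hx : x ∈ alcove n k)
    (hx' : x ∈ alcove n k') : k = k' := by
  funext p
  have h := Int.floor_eq_iff.2 ⟨(hx p).1.le, (hx p).2⟩
  have h' := Int.floor_eq_iff.2 ⟨(hx' p).1.le, (hx' p).2⟩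
  exact h.symm.trans h'

lemma pairwise_disjoint_alcove (n : ℕ) : Pairwise (Function.onFun Disjoint (alcove n)) :=
  fun _ _ hne => Set.disjoint_left.2 fun _ hx hx' => hne (alcove_eq_of_mem hx hx')

lemma walk_lt_walk_iff_of_mem_alcove {n : ℕ} {k : PosRoot n → ℤ} {x y : Fin n → ℝ}
    (hx : x ∈ alcove n k) (hy : y ∈ alcove n k) (i j : Fin (n + 1)) :
    walk n x i < walk n x j ↔ walk n y i < walk n y j := by
  rw [mem_alcove_iff] at hx hy
  rcases lt_trichotomy i j with h | rfl | h
  · have h1 := hx i j h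
    have h2 := hy i j h
    rcases lt_or_ge (k ⟨(i, j), h⟩) 0 with h0 | h0
    · have : (k ⟨(i, j), h⟩ : ℝ) + 1 ≤ 0 := by exact_mod_cast h0
      constructor <;> intro <;> linarith
    · have : (0 : ℝ) ≤ k ⟨(i, j), h⟩ := by exact_mod_cast h0
      constructor <;> intro <;> linarith
  · simp
  · have h1 := hx j i h
    have h2 := hy j i h
    rcases lt_or_ge (k ⟨(j, i), h⟩) 0 with h0 | h0
    · have : (k ⟨(j, i), h⟩ : ℝ) + 1 ≤ 0 := by exact_mod_cast h0
      constructor <;> intro <;> linarith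
    · have : (0 : ℝ) ≤ k ⟨(j, i), h⟩ := by exact_mod_cast h0
      constructor <;> intro <;> linarith

lemma mem_D_iff {n : ℕ} {π : Equiv.Perm (Fin (n + 1))} {x : Fin n → ℝ} :
    x ∈ D n π ↔ ∀ i j : Fin (n + 1), walk n x i < walk n x j ↔ π i < π j := by
  refine ⟨fun h => h.2, fun h => ⟨fun i j hij he => ?_, h⟩⟩
  rcases lt_or_gt_of_ne (π.injective.ne hij) with h' | h'
  · exact (((h i j).2 h').ne he)
  · exact (((h j i).2 h').ne he.symm)

lemma alcove_subset_D {n : ℕ} {π : Equiv.Perm (Fin (n + 1))} {k : PosRoot n → ℤ} {x : Fin n → ℝ}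
    (hx : x ∈ alcove n k) (hD : x ∈ D n π) : alcove n k ⊆ D n π := by
  intro y hy
  rw [mem_D_iff] at hD ⊢
  intro i j
  rw [walk_lt_walk_iff_of_mem_alcove hy hx, hD]

lemma shi_of_mem_alcove {n : ℕ} {k : PosRoot n → ℤ} {x : Fin n → ℝ} (hx : x ∈ alcove n k) :
    Shi n k := by
  rw [mem_alcove_iff] at hx
  intro i t j hit htj
  have h1 := hx i t hit
  have h2 := hx t j htj
  have h3 := hx i j (hit.trans htj)
  constructor
  · have : ((k ⟨(i, t), hit⟩ + k ⟨(t, j), htj⟩ : ℤ) : ℝ) < (k ⟨(i, j), hit.trans htj⟩ + 1 : ℤ) := by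
      push_cast
      linarith
    exact Int.lt_add_one_iff.1 (by exact_mod_cast this)
  · have : ((k ⟨(i, j), hit.trans htj⟩ : ℤ) : ℝ) <
        (k ⟨(i, t), hit⟩ + k ⟨(t, j), htj⟩ + 1 + 1 : ℤ) := by
      push_cast
      linarith
    exact Int.lt_add_one_iff.1 (by exact_mod_cast this)

instance (n : ℕ) : Finite (PosRoot n) := Subtype.finite

/-- Almost every point lies in an alcove. -/
lemma ae_exists_mem_alcove (n : ℕ) : ∀ᵐ x : Fin n → ℝ, ∃ k, x ∈ alcove n k := by
  have hne : ∀ᵐ x : Fin n → ℝ, ∀ (p : PosRoot n) (z : ℤ), psum n x p.1.1 p.1.2 ≠ z := by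
    simp only [ae_all_iff]
    rintro ⟨⟨i, j⟩, hij⟩ z
    have hij' : (i : ℕ) < j := hij
    let q : Fin n := ⟨i, by omega⟩
    let ℓ : (Fin n → ℝ) →ₗ[ℝ] ℝ := ∑ k : Fin n,
      if (i : ℕ) ≤ (k : ℕ) ∧ (k : ℕ) < (j : ℕ) then LinearMap.proj k else 0
    have hl : ∀ x, ℓ x = psum n x i j := by
      intro x
      simp only [ℓ, psum, LinearMap.sum_apply]
      refine Finset.sum_congr rfl fun k _ => ?_
      split_ifs <;> rfl
    have hl0 : ℓ ≠ 0 := by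
      intro h
      have h1 := hl (Pi.single q 1)
      rw [h, psum, Finset.sum_eq_single q] at h1
      · simp [q, hij'] at h1
      · intro b _ hb
        simp [hb]
      · simp
    have := volume_linear_eq_const hl0 z
    rw [ae_iff]
    simpa [hl] using this
  filter_upwards [hne] with x hx
  exact ⟨fun p => ⌊psum n x p.1.1 p.1.2⌋, fun p =>
    ⟨lt_of_le_of_ne (Int.floor_le _) (hx p _).symm, Int.lt_floor_add_one _⟩⟩

lemma abs_lt_of_mem_eball {n : ℕ} {r : ℝ} (hr : 0 < r) {x : Fin n → ℝ} (hx : x ∈ eball n r)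
    (i : Fin n) : |x i| < r := by
  refine abs_lt_of_sq_lt_sq (lt_of_le_of_lt ?_ hx) hr.le
  exact Finset.single_le_sum (f := fun i => x i ^ 2) (fun i _ => sq_nonneg _) (Finset.mem_univ i)

lemma touchingAlcoves_finite (n : ℕ) (π : Equiv.Perm (Fin (n + 1))) {r : ℝ} (hr : 0 < r) :
    (touchingAlcoves n π r).Finite := by
  obtain ⟨N, hN⟩ := exists_nat_gt (n * r)
  refine (Set.Finite.pi' fun _ : PosRoot n => Set.finite_Icc (-(N : ℤ) - 1) N).subset ?_
  rintro k ⟨-, -, x, hx, hB⟩ p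
  have hb : |psum n x p.1.1 p.1.2| ≤ n * r := by
    calc |psum n x p.1.1 p.1.2| ≤ ∑ k : Fin n, r := by
          refine (Finset.abs_sum_le_sum_abs _ _).trans (Finset.sum_le_sum fun i _ => ?_)
          split_ifs
          · exact (abs_lt_of_mem_eball hr hB i).le
          · simpa using hr.le
      _ = n * r := by simp
  rw [abs_le] at hb
  have := hx p
  have h1 : ((-(N : ℤ) - 1 : ℤ) : ℝ) < k p := by
    push_cast
    linarith
  have h2 : (k p : ℝ) < (N : ℤ) := by
    push_cast
    linarith
  exact ⟨(Int.cast_lt.1 h1).le, (Int.cast_lt.1 h2).le⟩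

lemma innerAlcoves_subset_touchingAlcoves (n : ℕ) (π : Equiv.Perm (Fin (n + 1))) (r : ℝ) :
    innerAlcoves n π r ⊆ touchingAlcoves n π r := by
  rintro k ⟨hk, hD, hB⟩
  obtain ⟨x, hx⟩ := hk.alcove_nonempty
  exact ⟨hk, hD, x, hx, hB hx⟩

lemma volume_biUnion_alcove {n : ℕ} {S : Set (PosRoot n → ℤ)} (hS : S.Finite)
    (hshi : ∀ k ∈ S, Shi n k) :
    volume (⋃ k ∈ S, alcove n k) = S.ncard * (n.factorial : ENNReal)⁻¹ := by
  have h := measure_biUnion_finset (μ := volume) (s := hS.toFinset) (f := alcove n)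
    (fun k _ k' _ hne => pairwise_disjoint_alcove n hne) fun k _ => measurableSet_alcove n k
  simp only [Set.Finite.mem_toFinset] at h
  rw [h, Finset.sum_congr rfl fun k hk => (hshi k (hS.mem_toFinset.1 hk)).volume_alcove]
  simp [Set.ncard_eq_toFinset_card S hS]

lemma isOpen_eball (n : ℕ) (r : ℝ) : IsOpen (eball n r) :=
  isOpen_lt (by fun_prop) continuous_const

lemma volume_eball_ne_zero (n : ℕ) {r : ℝ} (hr : 0 < r) : volume (eball n r) ≠ 0 :=
  ((isOpen_eball n r).measure_pos volume ⟨0, by simpa [eball] using pow_pos hr 2⟩).ne'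

lemma volume_eball_ne_top (n : ℕ) {r : ℝ} (hr : 0 < r) : volume (eball n r) ≠ ⊤ := by
  refine ((measure_mono (t := Set.Icc (fun _ => -r) fun _ => r) fun x hx => ?_).trans_lt
    isCompact_Icc.measure_lt_top).ne
  exact ⟨fun i => (abs_lt.1 (abs_lt_of_mem_eball hr hx i)).1.le,
    fun i => (abs_lt.1 (abs_lt_of_mem_eball hr hx i)).2.le⟩

open scoped Pointwise in
/-- The part of a cone in a ball scales with the radius. -/
lemma volume_inter_eball {n : ℕ} {K : Set (Fin n → ℝ)} (hK : ∀ c : ℝ, 0 < c → ∀ x ∈ K, c • x ∈ K)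
    {r s : ℝ} (hr : 0 < r) (hs : 0 < s) :
    volume (K ∩ eball n s) = ENNReal.ofReal ((s / r) ^ n) * volume (K ∩ eball n r) := by
  have hc : 0 < s / r := by positivity
  have hset : K ∩ eball n s = (s / r) • (K ∩ eball n r) := by
    ext x
    rw [Set.mem_smul_set_iff_inv_smul_mem₀ hc.ne']
    have hsum : ∑ i, ((s / r)⁻¹ • x) i ^ 2 = (r / s) ^ 2 * ∑ i, x i ^ 2 := by
      rw [Finset.mul_sum]
      refine Finset.sum_congr rfl fun i _ => ?_
      simp [mul_pow]
    refine and_congr ⟨fun h => hK _ (inv_pos.2 hc) x h, fun h => ?_⟩ ?_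
    · simpa only [smul_inv_smul₀ hc.ne'] using hK _ hc _ h
    · simp only [eball, Set.mem_ofPred_eq]
      rw [hsum, div_pow, div_mul_eq_mul_div, div_lt_iff₀ (by positivity),
        mul_lt_mul_iff_right₀ (by positivity)]
  rw [hset, Measure.addHaar_smul]
  simp [abs_of_pos hc]

lemma volume_inter_eball_mul {n : ℕ} {K : Set (Fin n → ℝ)}
    (hK : ∀ c : ℝ, 0 < c → ∀ x ∈ K, c • x ∈ K) {r s : ℝ} (hr : 0 < r) (hs : 0 < s) :
    volume (K ∩ eball n s) * volume (eball n r) =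
      volume (eball n s) * volume (K ∩ eball n r) := by
  have h := volume_inter_eball (K := Set.univ) (fun _ _ _ _ => trivial) hr hs (n := n)
  rw [Set.univ_inter, Set.univ_inter] at h
  rw [volume_inter_eball hK hr hs, h]
  ring

/-- The standard normal density on `ℝ^n`. -/
def stdGaussianDensity (n : ℕ) (x : Fin n → ℝ) : ℝ :=
  ∏ i : Fin n, Real.exp (-(x i) ^ 2 / 2) / Real.sqrt (2 * Real.pi)

lemma stdGaussianDensity_eq_prod (n : ℕ) (x : Fin n → ℝ) :
    stdGaussianDensity n x = ∏ i, ProbabilityTheory.gaussianPDFReal 0 1 (x i) := by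
  refine Finset.prod_congr rfl fun i _ => ?_
  simp [ProbabilityTheory.gaussianPDFReal, div_eq_inv_mul]

lemma stdGaussianDensity_eq_exp (n : ℕ) (x : Fin n → ℝ) :
    stdGaussianDensity n x =
      Real.exp (-(∑ i, x i ^ 2) / 2) * (Real.sqrt (2 * Real.pi) ^ n)⁻¹ := by
  rw [stdGaussianDensity, Finset.prod_div_distrib, ← Real.exp_sum, ← Finset.sum_div,
    Finset.sum_neg_distrib, Finset.prod_const, Finset.card_univ, Fintype.card_fin, div_eq_mul_inv]

lemma stdGaussianDensity_nonneg (n : ℕ) (x : Fin n → ℝ) : 0 ≤ stdGaussianDensity n x :=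
  Finset.prod_nonneg fun _ _ => by positivity

lemma measurable_stdGaussianDensity (n : ℕ) : Measurable (stdGaussianDensity n) := by
  unfold stdGaussianDensity
  fun_prop

lemma integrable_stdGaussianDensity (n : ℕ) : Integrable (stdGaussianDensity n) := by
  have h := Integrable.fintype_prod (μ := fun _ : Fin n => (volume : Measure ℝ))
    fun _ : Fin n => ProbabilityTheory.integrable_gaussianPDFReal 0 1
  exact h.congr (ae_of_all _ fun x => (stdGaussianDensity_eq_prod n x).symm)

lemma integral_stdGaussianDensity (n : ℕ) : ∫ x, stdGaussianDensity n x = 1 := by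
  simp_rw [stdGaussianDensity_eq_prod]
  rw [integral_fintype_prod_volume_eq_pow,
    ProbabilityTheory.integral_gaussianPDFReal_eq_one 0 one_ne_zero, one_pow]

lemma superlevel_stdGaussianDensity (n : ℕ) {t : ℝ} (ht : 0 < t) :
    {x | t < stdGaussianDensity n x} = ∅ ∨
      ∃ s : ℝ, 0 < s ∧ {x | t < stdGaussianDensity n x} = eball n s := by
  let A : ℝ := Real.sqrt (2 * Real.pi) ^ n
  have hA : 0 < A := by positivity
  have hiff : ∀ x, t < stdGaussianDensity n x ↔ ∑ i, x i ^ 2 < -2 * Real.log (t * A) := by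
    intro x
    rw [stdGaussianDensity_eq_exp, ← div_eq_mul_inv, lt_div_iff₀ hA,
      ← Real.log_lt_iff_lt_exp (by positivity)]
    constructor <;> intro h <;> linarith
  rcases le_or_gt (-2 * Real.log (t * A)) 0 with h0 | h0
  · left
    ext x
    have : 0 ≤ ∑ i, x i ^ 2 := Finset.sum_nonneg fun i _ => sq_nonneg _
    simpa [hiff] using h0.trans this
  · refine Or.inr ⟨_, Real.sqrt_pos.2 h0, ?_⟩
    ext x
    rw [Set.mem_ofPred_eq, hiff, eball, Set.mem_ofPred_eq, Real.sq_sqrt h0.le]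

/-- The Gaussian measure of a cone is the fraction of a centered ball that it occupies. -/
lemma setIntegral_stdGaussianDensity_cone {n : ℕ} {K : Set (Fin n → ℝ)}
    (hK : ∀ c : ℝ, 0 < c → ∀ x ∈ K, c • x ∈ K) {r : ℝ} (hr : 0 < r) :
    ∫ x in K, stdGaussianDensity n x =
      (volume (K ∩ eball n r)).toReal / (volume (eball n r)).toReal := by
  have hB0 := volume_eball_ne_zero n hr
  have hBt := volume_eball_ne_top n hr
  have hKt : volume (K ∩ eball n r) ≠ ⊤ := measure_ne_top_of_subset Set.inter_subset_right hBt
  have hlayer : ∀ μ : Measure (Fin n → ℝ), ∫⁻ x, ENNReal.ofReal (stdGaussianDensity n x) ∂μ =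
      ∫⁻ t in Set.Ioi 0, μ {x | t < stdGaussianDensity n x} := fun μ =>
    lintegral_eq_lintegral_meas_lt μ (ae_of_all _ (stdGaussianDensity_nonneg n))
      (measurable_stdGaussianDensity n).aemeasurable
  have hone : ∫⁻ x, ENNReal.ofReal (stdGaussianDensity n x) = 1 := by
    rw [← ofReal_integral_eq_lintegral_ofReal (integrable_stdGaussianDensity n)
      (ae_of_all _ (stdGaussianDensity_nonneg n)), integral_stdGaussianDensity, ENNReal.ofReal_one]
  have hmul : (∫⁻ x in K, ENNReal.ofReal (stdGaussianDensity n x)) * volume (eball n r) =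
      volume (K ∩ eball n r) := by
    rw [← one_mul (volume (K ∩ eball n r)), ← hone, hlayer, hlayer,
      ← lintegral_mul_const' _ _ hBt, ← lintegral_mul_const' _ _ hKt]
    refine setLIntegral_congr_fun measurableSet_Ioi fun t ht => ?_
    rcases superlevel_stdGaussianDensity n ht with h | ⟨s, hs, h⟩
    · simp [h]
    · simp only [h]
      rw [Measure.restrict_apply (isOpen_eball n s).measurableSet, Set.inter_comm,
        volume_inter_eball_mul hK hr hs]
  rw [integral_eq_lintegral_of_nonneg_ae (ae_of_all _ (stdGaussianDensity_nonneg n))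
    (integrable_stdGaussianDensity n).aestronglyMeasurable.restrict, ← hmul, ENNReal.toReal_mul,
    mul_div_cancel_right₀ _ (ENNReal.toReal_ne_zero.2 ⟨hB0, hBt⟩)]

/-- alcove-counting bounds on `P(f,π)` for the standard normal density. -/
theorem stmt_19 (n : ℕ) (hn : 1 ≤ n) (π : Equiv.Perm (Fin (n + 1)))
    (r : ℝ) (hr : 0 < r) :
    (innerAlcoves n π r).Finite ∧ (touchingAlcoves n π r).Finite ∧
    ((innerAlcoves n π r).ncard : ℝ) /
        ((n.factorial : ℝ) * (volume (eball n r)).toReal) ≤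
      ∫ x in D n π, ∏ i : Fin n, Real.exp (-(x i) ^ 2 / 2) / Real.sqrt (2 * Real.pi) ∧
    (∫ x in D n π, ∏ i : Fin n, Real.exp (-(x i) ^ 2 / 2) / Real.sqrt (2 * Real.pi)) ≤
      ((touchingAlcoves n π r).ncard : ℝ) /
        ((n.factorial : ℝ) * (volume (eball n r)).toReal) := by
  have htouch := touchingAlcoves_finite n π hr
  have hinner := htouch.subset (innerAlcoves_subset_touchingAlcoves n π r)
  have hBt := volume_eball_ne_top n hr
  have hDt : volume (D n π ∩ eball n r) ≠ ⊤ :=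
    measure_ne_top_of_subset Set.inter_subset_right hBt
  have hint : (∫ x in D n π, ∏ i : Fin n, Real.exp (-(x i) ^ 2 / 2) / Real.sqrt (2 * Real.pi)) =
      (volume (D n π ∩ eball n r)).toReal / (volume (eball n r)).toReal :=
    setIntegral_stdGaussianDensity_cone (fun c hc x hx => smul_mem_D hc hx) hr
  have hvi := volume_biUnion_alcove hinner fun k hk => hk.1
  have hvt := volume_biUnion_alcove htouch fun k hk => hk.1
  have hreal : ∀ a : ℕ, ((a : ENNReal) * (n.factorial : ENNReal)⁻¹).toReal = a / n.factorial :=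
    fun a => by simp [div_eq_mul_inv]
  have hfin : ∀ a : ℕ, (a : ENNReal) * (n.factorial : ENNReal)⁻¹ ≠ ⊤ := fun a =>
    ENNReal.mul_ne_top (ENNReal.natCast_ne_top a)
      (ENNReal.inv_ne_top.2 (by exact_mod_cast n.factorial_ne_zero))
  refine ⟨hinner, htouch, ?_, ?_⟩
  · rw [hint, ← div_div]
    refine div_le_div_of_nonneg_right ?_ ENNReal.toReal_nonneg
    rw [← hreal, ← hvi]
    exact ENNReal.toReal_mono hDt (measure_mono
      (Set.iUnion₂_subset fun k hk => Set.subset_inter hk.2.1 hk.2.2))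
  · rw [hint, ← div_div]
    refine div_le_div_of_nonneg_right ?_ ENNReal.toReal_nonneg
    rw [← hreal]
    refine ENNReal.toReal_mono (hfin _) ?_
    rw [← hvt]
    refine measure_mono_ae ?_
    filter_upwards [ae_exists_mem_alcove n] with x ⟨k, hk⟩ hx
    exact Set.mem_biUnion (x := k)
      ⟨shi_of_mem_alcove hk, alcove_subset_D hk hx.1, x, hk, hx.2⟩ hk
end
end
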